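/- Let n be divisible by 4 and d = n/2. Then there exist n(n−3)/2 Hamiltonian cycles H_1, …, H_{n(n−3)/2} on the complete graph with vertex set ZMod n, each with circlet cost exactly n − 2, such that their edge-incidence vectors χ_{H_1}, …, χ_{H_{n(n−3)/2}} (viewed as real-valued functions on the edge set of K_n, taking value 1 on edges of the cycle and 0 elsewhere) are linearly independent. (This is the content of the circlet inequality being facet-defining for the symmetric TSP polytope STSP(n).) -/

import Mathlib

/-- The length of an edge of the complete graph on `ZMod n`:
`ℓ(i,j) = min(|i−j|, n−|i−j|)`, expressed as `min (i-j).val (j-i).val`. -/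
def zLenSym {n : ℕ} : Sym2 (ZMod n) → ℕ :=
  Sym2.lift ⟨fun i j => min (i - j).val (j - i).val, fun i j => min_comm _ _⟩

/-- The circlet cost of an edge: its length `ℓ` if `ℓ` is odd, and `d − ℓ` if `ℓ` is even. -/
def circCost {n : ℕ} (d : ℕ) (e : Sym2 (ZMod n)) : ℕ :=
  if Odd (zLenSym e) then zLenSym e else d - zLenSym e

namespace Circlet

/-- Sum of `f` over consecutive pairs of a list. -/
def pth {α M : Type*} [AddCommMonoid M] (f : α → α → M) : List α → M
  | [] => 0
  | [_] => 0
  | x :: y :: l => f x y + pth f (y :: l)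

/-- Sum of `f` over cyclically consecutive pairs of a list. -/
def cyc {α M : Type*} [AddCommMonoid M] (f : α → α → M) : List α → M
  | [] => 0
  | x :: l => pth f (x :: (l ++ [x]))

section
variable {α β M : Type*} [AddCommMonoid M]

theorem pth_append (f : α → α → M) (l : List α) (x : α) (r : List α) :
    pth f (l ++ x :: r) = pth f (l ++ [x]) + pth f (x :: r) := by
  induction l with
  | nil => simp [pth]
  | cons y l ih =>
    cases l with
    | nil => simp [pth]
    | cons z l => simp only [List.cons_append, pth] at ih ⊢; rw [ih, add_assoc]

theorem pth_map (f : α → α → M) (g : β → α) (l : List β) :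
    pth f (l.map g) = pth (fun i j => f (g i) (g j)) l := by
  induction l with
  | nil => simp [pth]
  | cons y l ih =>
    cases l with
    | nil => simp [pth]
    | cons z l => simp only [List.map_cons, pth] at ih ⊢; rw [ih]

theorem cyc_map (f : α → α → M) (g : β → α) (l : List β) :
    cyc f (l.map g) = cyc (fun i j => f (g i) (g j)) l := by
  cases l with
  | nil => rfl
  | cons x l =>
    have := pth_map f g (x :: (l ++ [x]))
    simpa [cyc] using this

theorem pth_reverse (f : α → α → M) (l : List α) :
    pth f l.reverse = pth (fun x y => f y x) l := by
  induction l with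
  | nil => simp [pth]
  | cons y l ih =>
    cases l with
    | nil => simp [pth]
    | cons z l =>
      have h := pth_append f l.reverse z [y]
      simp only [List.reverse_cons, List.append_assoc, List.singleton_append] at ih h ⊢
      rw [h, ih]
      simp [pth, add_comm]

/-- The list visiting each `p` and then `p + d`. -/
def flat (d : ℕ) (q : List ℕ) : List ℕ := q.flatMap fun p => [p, p + d]

theorem pth_flat (h : ℕ → ℕ → M) (d : ℕ) (q : List ℕ) (z : ℕ) :
    pth h (flat d q ++ [z]) =
      (q.map fun p => h p (p + d)).sum + pth (fun p r => h (p + d) r) (q ++ [z]) := by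
  induction q with
  | nil => simp [pth, flat]
  | cons y l ih =>
    cases l with
    | nil => simp [pth, flat]
    | cons w l =>
      simp only [flat, List.flatMap_cons, List.cons_append, List.nil_append, pth,
        List.map_cons, List.sum_cons] at ih ⊢
      rw [ih]
      abel

theorem cyc_flat (h : ℕ → ℕ → M) (d : ℕ) (x : ℕ) (q : List ℕ) :
    cyc h (flat d (x :: q)) =
      ((x :: q).map fun p => h p (p + d)).sum + pth (fun p r => h (p + d) r) (x :: q ++ [x]) := by
  rw [← pth_flat]
  simp [flat, cyc]

end

theorem flat_perm {d : ℕ} {q : List ℕ} (hq : q.Perm (List.range d)) :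
    (flat d q).Perm (List.range (2 * d)) := by
  have h1 : (flat d q).Perm (flat d (List.range d)) := hq.flatMap_right _
  refine h1.trans ?_
  have hn : (List.range d).Nodup := List.nodup_range
  refine (List.perm_ext_iff_of_nodup ?_ List.nodup_range).2 ?_
  · unfold flat
    rw [List.nodup_flatMap]
    constructor
    · intro x hx
      simp at hx ⊢; omega
    · refine List.Pairwise.imp_of_mem ?_ hn
      intro a b ha hb hab
      simp [Function.onFun] at ha hb ⊢; omega
  · intro x
    simp only [flat, List.mem_flatMap, List.mem_range, List.mem_cons, List.not_mem_nil, or_false]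
    constructor
    · rintro ⟨y, h, h | h⟩ <;> omega
    · intro h
      by_cases h' : x < d
      · exact ⟨x, h', Or.inl rfl⟩
      · exact ⟨x - d, by omega, Or.inr (by omega)⟩

/-- telescoping on sorted lists -/
theorem pth_sorted (g : ℕ → ℕ → ℕ) (d : ℕ) (hg : ∀ p q, p < q → q < d → g p q = q - p)
    (x y : ℕ) (l : List ℕ) (hs : (x :: l ++ [y]).Pairwise (· < ·)) (hy : y < d) :
    pth g (x :: l ++ [y]) = y - x ∧ x < y := by
  induction l generalizing x with
  | nil =>
    have : x < y := by simpa using hs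
    simp [pth, hg x y this hy, this]
  | cons z l ih =>
    have h1 := ih z (by simp only [List.cons_append, List.pairwise_cons] at hs ⊢; exact hs.2)
    have hxz : x < z := by
      simp only [List.cons_append, List.pairwise_cons] at hs; exact hs.1 z (by simp)
    simp only [List.cons_append, pth] at h1 ⊢
    rw [h1.1, hg x z hxz (by omega)]
    omega


theorem ud_split {M : Type*} [AddCommMonoid M] (h : ℕ → ℕ → M) (d : ℕ) (U D : List ℕ)
    (hP : (0 :: (U ++ [d - 1] ++ D.reverse)).Perm (List.range d)) :
    cyc h (flat d (0 :: (U ++ [d - 1] ++ D.reverse))) =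
      ((List.range d).map fun p => h p (p + d)).sum +
      (pth (fun p r => h (p + d) r) (0 :: U ++ [d - 1]) +
       pth (fun p r => h (r + d) p) (0 :: D ++ [d - 1])) := by
  rw [cyc_flat, (hP.map _).sum_eq]
  congr 1
  have e : (0 :: (U ++ [d - 1] ++ D.reverse) ++ [0]) =
      (0 :: U) ++ (d - 1) :: (D.reverse ++ [0]) := by simp
  rw [e, pth_append]
  congr 1
  have e2 : (d - 1) :: (D.reverse ++ [0]) = (0 :: D ++ [d - 1]).reverse := by simp
  rw [e2, pth_reverse]

theorem ud_perm (d : ℕ) (hd : 2 ≤ d) (U D : List ℕ)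
    (hP : (U ++ D).Perm (List.range' 1 (d - 2))) :
    (0 :: (U ++ [d - 1] ++ D.reverse)).Perm (List.range d) := by
  have e : List.range d = 0 :: (List.range' 1 (d - 2) ++ [d - 1]) := by
    obtain ⟨k, rfl⟩ : ∃ k, d = k + 2 := ⟨d - 2, by omega⟩
    have := @List.range'_concat 1 (s := 1) (n := k)
    rw [List.range_eq_range', List.range'_succ]
    simp only [Nat.add_sub_cancel, zero_add] at this ⊢
    rw [this]
    simp [add_comm]
  rw [e]
  refine List.Perm.cons _ ?_
  refine List.Perm.trans ?_ (hP.append_right _)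
  rw [List.append_assoc, List.append_assoc]
  refine List.Perm.append_left _ ?_
  exact List.perm_append_comm.trans ((List.reverse_perm D).append_right _)

/-- What we need to know on costs in the antipodal coordinates. -/
def GoodCost (d : ℕ) (c : ℕ → ℕ → ℕ) : Prop :=
  ∀ p q, p ≤ q → q < d → c (p + d) q = q - p ∧ c q (p + d) = q - p ∧ c p (q + d) = q - p ∧
    c (q + d) p = q - p

section core
variable {d : ℕ} {c : ℕ → ℕ → ℕ}

theorem diag_cost (hc : GoodCost d c) : ((List.range d).map fun p => c p (p + d)).sum = 0 := by
  rw [List.sum_eq_zero]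
  intro x hx
  simp only [List.mem_map, List.mem_range] at hx
  obtain ⟨p, hp, rfl⟩ := hx
  simpa using (hc p p le_rfl hp).2.2.1

theorem ud_tight (hc : GoodCost d c) (hd : 2 ≤ d) (U D : List ℕ)
    (hP : (U ++ D).Perm (List.range' 1 (d - 2)))
    (hU : (0 :: U ++ [d - 1]).Pairwise (· < ·)) (hD : (0 :: D ++ [d - 1]).Pairwise (· < ·)) :
    cyc c (flat d (0 :: (U ++ [d - 1] ++ D.reverse))) = 2 * d - 2 := by
  rw [ud_split c d U D (ud_perm d hd U D hP), diag_cost hc,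
    (pth_sorted _ d (fun p q hpq hq => (hc p q hpq.le hq).1) _ _ U hU (by omega)).1,
    (pth_sorted _ d (fun p q hpq hq => (hc p q hpq.le hq).2.2.2) _ _ D hD (by omega)).1]
  omega

end core

/-- The functional `f` vanishes on all tight tours. -/
def Vanishes (d : ℕ) (c : ℕ → ℕ → ℕ) (f : ZMod (2 * d) → ZMod (2 * d) → ℝ) : Prop :=
  ∀ (a : ZMod (2 * d)) (L : List ℕ), L.Perm (List.range (2 * d)) → cyc c L = 2 * d - 2 →
    cyc (fun i j => f (a + (i : ℕ)) (a + (j : ℕ))) L = 0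

section core2
variable {d : ℕ} {c : ℕ → ℕ → ℕ} {f : ZMod (2 * d) → ZMod (2 * d) → ℝ}

/-- Edge of displacement `l` after the antipode of `a`. -/
def K (f : ZMod (2 * d) → ZMod (2 * d) → ℝ) (a : ZMod (2 * d)) (l : ℕ) : ℝ := f (a + d) (a + l)

theorem two_d : (d : ZMod (2 * d)) + d = 0 := by
  have := ZMod.natCast_self (2 * d)
  push_cast at this
  rw [← this]; ring

theorem K_up (f : ZMod (2 * d) → ZMod (2 * d) → ℝ) (a : ZMod (2 * d)) {p q : ℕ} (h : p ≤ q) :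
    f (a + (p + d : ℕ)) (a + q) = K f (a + p) (q - p) := by
  unfold K
  push_cast [Nat.cast_sub h]
  congr 1 <;> ring

theorem K_down (f : ZMod (2 * d) → ZMod (2 * d) → ℝ) (hs : ∀ x y, f x y = f y x)
    (a : ZMod (2 * d)) {p q : ℕ} (h : p ≤ q) :
    f (a + (q + d : ℕ)) (a + p) = K f (a + d + p) (q - p) := by
  unfold K
  rw [hs]
  push_cast [Nat.cast_sub h]
  congr 1
  · linear_combination -(two_d (d := d))
  · ring

theorem ud_eq (hc : GoodCost d c) (hf : Vanishes d c f) (hd : 2 ≤ d)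
    (a : ZMod (2 * d)) (U D : List ℕ)
    (hP : (U ++ D).Perm (List.range' 1 (d - 2)))
    (hU : (0 :: U ++ [d - 1]).Pairwise (· < ·)) (hD : (0 :: D ++ [d - 1]).Pairwise (· < ·)) :
    ((List.range d).map fun p : ℕ => f (a + p) (a + (p + d : ℕ))).sum +
      (pth (fun p r : ℕ => f (a + (p + d : ℕ)) (a + r)) (0 :: U ++ [d - 1]) +
       pth (fun p r : ℕ => f (a + (r + d : ℕ)) (a + p)) (0 :: D ++ [d - 1])) = 0 := by
  have h1 := ud_perm d hd U D hP
  rw [← ud_split (fun i j : ℕ => f (a + i) (a + j)) d U D h1]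
  exact hf a _ (flat_perm h1) (ud_tight hc hd U D hP hU hD)

/-- The triangle defect. -/
def F (f : ZMod (2 * d) → ZMod (2 * d) → ℝ) (s : ZMod (2 * d)) (r t : ℕ) : ℝ :=
  K f s r + K f (s + r) (t - r) - K f s t

theorem range'_snoc (s m : ℕ) : List.range' s (m + 1) = List.range' s m ++ [s + m] := by
  simpa using @List.range'_concat 1 (s := s) (n := m)

theorem pw_range' (s m : ℕ) : (List.range' s m).Pairwise (· < ·) := List.pairwise_lt_range'

theorem nd_range' (s m : ℕ) : (List.range' s m).Nodup := List.nodup_range'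

/-- exchange lemma -/
theorem exch (hc : GoodCost d c) (hf : Vanishes d c f) (hs : ∀ x y, f x y = f y x)
    (a : ZMod (2 * d)) (r t e : ℕ) (hr : 1 ≤ r) (hrt : r < t) (ht : t < d)
    (he : e = if t = r + 1 then d - 1 else r + 1) :
    F f a r t = F f (a + d + (r - 1 : ℕ)) 1 (e - (r - 1)) := by
  obtain ⟨Z, hZ⟩ : ∃ Z, List.range' t (d - 1 - t) ++ [d - 1] = t :: Z := by
    refine ⟨List.range' (t + 1) (d - 1 - t), ?_⟩
    have h1 := range'_snoc t (d - 1 - t)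
    rw [List.range'_succ] at h1
    rw [h1]
    simp; omega
  obtain ⟨Y, hY⟩ : ∃ Y, List.range' (r + 1) (t - 1 - r) ++ [d - 1] = e :: Y := by
    split_ifs at he with h
    · subst h; exact ⟨[], by simp [he]⟩
    · refine ⟨List.range' (r + 1 + 1) (t - 1 - r - 1) ++ [d - 1], ?_⟩
      obtain ⟨m, hm⟩ : ∃ m, t - 1 - r = m + 1 := ⟨t - 1 - r - 1, by omega⟩
      rw [hm, List.range'_succ, he]
      simp
  have hX : 0 :: List.range' 1 (r - 1) = List.range' 0 (r - 1) ++ [r - 1] := by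
    have := range'_snoc 0 (r - 1)
    rw [List.range'_succ] at this
    simpa using this
  have hsp : List.range' 1 (t - 1) =
      List.range' 1 (r - 1) ++ r :: List.range' (r + 1) (t - 1 - r) := by
    obtain ⟨m, rfl⟩ : ∃ m, r = m + 1 := ⟨r - 1, by omega⟩
    obtain ⟨j, rfl⟩ : ∃ j, t = m + 1 + 1 + j := ⟨t - (m + 2), by omega⟩
    have h1 : m + 1 + 1 + j - 1 = m + (j + 1) := by omega
    have h2 : m + 1 + 1 + j - 1 - (m + 1) = j := by omega
    rw [h2, h1, ← List.range'_append_1, List.range'_succ]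
    simp [add_comm]
  have E1 := ud_eq hc hf (by omega) a (List.range' t (d - 1 - t)) (List.range' 1 (t - 1))
    (by
      refine (List.perm_ext_iff_of_nodup ?_ List.nodup_range').2 ?_
      · rw [List.nodup_append]
        refine ⟨List.nodup_range', List.nodup_range', ?_⟩
        intro x hx y hy
        simp only [List.mem_range'_1] at hx hy; omega
      · intro x
        simp only [List.mem_append, List.mem_range'_1]; omega)
    (by
      simp only [List.cons_append, List.pairwise_cons, List.pairwise_append, pw_range',
        List.mem_append, List.mem_range'_1, List.mem_singleton, List.not_mem_nil]
      grind)
    (by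
      simp only [List.cons_append, List.pairwise_cons, List.pairwise_append, pw_range',
        List.mem_append, List.mem_range'_1, List.mem_singleton, List.not_mem_nil]
      grind)
  have E2 := ud_eq hc hf (by omega) a (r :: List.range' t (d - 1 - t))
    (List.range' 1 (r - 1) ++ List.range' (r + 1) (t - 1 - r))
    (by
      refine (List.perm_ext_iff_of_nodup ?_ List.nodup_range').2 ?_
      · simp only [List.cons_append, List.nodup_cons, List.nodup_append, List.mem_append,
          nd_range', List.mem_range'_1]
        clear E1 hZ hY hX hsp
        grind
      · intro x
        simp only [List.cons_append, List.mem_cons, List.mem_append, List.mem_range'_1]; omega)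
    (by
      simp only [List.cons_append, List.pairwise_cons, List.pairwise_append, pw_range',
        List.mem_cons, List.mem_append, List.mem_range'_1, List.mem_singleton, List.not_mem_nil]
      grind)
    (by
      simp only [List.cons_append, List.pairwise_cons, List.pairwise_append, pw_range',
        List.mem_append, List.mem_range'_1, List.mem_singleton, List.not_mem_nil]
      grind)
  have q1 : 0 :: List.range' t (d - 1 - t) ++ [d - 1] = 0 :: t :: Z := by
    rw [List.cons_append, hZ]
  have q2 : 0 :: (r :: List.range' t (d - 1 - t)) ++ [d - 1] = 0 :: r :: t :: Z := by
    rw [List.cons_append, List.cons_append, hZ]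
  have q3 : 0 :: List.range' 1 (t - 1) ++ [d - 1] =
      List.range' 0 (r - 1) ++ (r - 1) :: r :: e :: Y := by
    rw [hsp, ← List.cons_append, hX]
    simp only [List.append_assoc, List.cons_append, List.nil_append, hY]
  have q4 : 0 :: (List.range' 1 (r - 1) ++ List.range' (r + 1) (t - 1 - r)) ++ [d - 1] =
      List.range' 0 (r - 1) ++ (r - 1) :: e :: Y := by
    rw [← List.cons_append, hX]
    simp only [List.append_assoc, List.cons_append, List.nil_append, hY]
  rw [q1, q3, pth_append] at E1
  rw [q2, q4, pth_append] at E2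
  have hre : r ≤ e := by split_ifs at he <;> omega
  simp only [pth] at E1 E2
  rw [K_up f a (Nat.zero_le t), K_down f hs a (show r - 1 ≤ r by omega), K_down f hs a hre] at E1
  rw [K_up f a (Nat.zero_le r), K_up f a hrt.le, K_down f hs a (show r - 1 ≤ e by omega)] at E2
  have h1 : r - (r - 1) = 1 := by omega
  have h2 : e - (r - 1) - 1 = e - r := by omega
  have h3 : a + d + ((r - 1 : ℕ) : ZMod (2 * d)) + (1 : ℕ) = a + d + r := by
    rw [add_assoc, ← Nat.cast_add, Nat.sub_add_cancel hr]
  unfold F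
  rw [h2, h3]
  rw [h1] at E1
  simp only [Nat.cast_zero, add_zero, Nat.sub_zero] at E1 E2
  linarith

end core2

section mtours

/-- Initial part shared by the three special tours. -/
def base (k : ℕ) : List ℕ := flat (k + 4) (List.range (k + 1))

theorem base_cons (k : ℕ) : ∃ B, base k = 0 :: B := by
  refine ⟨(k + 4) :: flat (k + 4) (List.range' 1 k), ?_⟩
  simp [base, flat, List.range_eq_range', List.range'_succ]

theorem cyc_W0 {M : Type*} [AddCommMonoid M] (h : ℕ → ℕ → M) (k : ℕ) :
    cyc h (base k ++ [k + 1, k + 1 + (k + 4), k + 2, k + 2 + (k + 4), k + 3, k + 3 + (k + 4)]) =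
      pth h (base k ++ [k + 1]) + (h (k + 1) (k + 1 + (k + 4)) + (h (k + 1 + (k + 4)) (k + 2) +
      (h (k + 2) (k + 2 + (k + 4)) + (h (k + 2 + (k + 4)) (k + 3) +
      (h (k + 3) (k + 3 + (k + 4)) + h (k + 3 + (k + 4)) 0))))) := by
  obtain ⟨B, hB⟩ := base_cons k
  rw [hB]
  have := pth_append h (0 :: B) (k + 1) [k + 1 + (k + 4), k + 2, k + 2 + (k + 4), k + 3,
    k + 3 + (k + 4), 0]
  simp only [cyc, List.cons_append, List.append_assoc, List.nil_append] at this ⊢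
  rw [this]
  simp [pth]

theorem cyc_W1 {M : Type*} [AddCommMonoid M] (h : ℕ → ℕ → M) (k : ℕ) (a b c d e f : ℕ) :
    cyc h ([a, b, c, d, e, f] ++ base k) =
      h a b + (h b c + (h c d + (h d e + (h e f + (h f 0 + pth h (base k ++ [a])))))) := by
  obtain ⟨B, hB⟩ := base_cons k
  rw [hB]
  simp [cyc, pth]

theorem W0_perm (k : ℕ) :
    (base k ++ [k + 1, k + 1 + (k + 4), k + 2, k + 2 + (k + 4), k + 3, k + 3 + (k + 4)]).Perm
      (List.range (2 * (k + 4))) := by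
  have h := flat_perm (d := k + 4) (List.Perm.refl _)
  have e : flat (k + 4) (List.range (k + 4)) =
      base k ++ [k + 1, k + 1 + (k + 4), k + 2, k + 2 + (k + 4), k + 3, k + 3 + (k + 4)] := by
    simp [base, flat, List.range_succ]
  rwa [e] at h

theorem W1_perm (k : ℕ) :
    ([k + 1, k + 2 + (k + 4), k + 2, k + 3 + (k + 4), k + 3, k + 1 + (k + 4)] ++ base k).Perm
      (List.range (2 * (k + 4))) := by
  refine List.Perm.trans ?_ (W0_perm k)
  refine List.Perm.trans List.perm_append_comm (List.Perm.append_left _ ?_)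
  rw [List.perm_iff_count]
  intro x
  simp only [List.count_cons]
  omega

theorem W2_perm (k : ℕ) :
    ([k + 1, k + 3 + (k + 4), k + 3, k + 2 + (k + 4), k + 2, k + 1 + (k + 4)] ++ base k).Perm
      (List.range (2 * (k + 4))) := by
  refine List.Perm.trans ?_ (W0_perm k)
  refine List.Perm.trans List.perm_append_comm (List.Perm.append_left _ ?_)
  rw [List.perm_iff_count]
  intro x
  simp only [List.count_cons]
  omega

theorem base_cost {k : ℕ} {c : ℕ → ℕ → ℕ} (hc : GoodCost (k + 4) c) :
    pth c (base k ++ [k + 1]) = k + 1 := by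
  unfold base
  rw [pth_flat, List.sum_eq_zero]
  · have e : List.range (k + 1) = 0 :: List.range' 1 k := by
      simp [List.range_eq_range', List.range'_succ]
    have e2 : List.range (k + 1) ++ [k + 1] = List.range (k + 2) := by
      simp [List.range_succ]
    have := (pth_sorted (fun p r => c (p + (k + 4)) r) (k + 4)
      (fun p q hpq hq => (hc p q hpq.le hq).1) 0 (k + 1) (List.range' 1 k) (by
        rw [← e, e2]; exact List.pairwise_lt_range) (by omega)).1
    rw [e, this]; omega
  · intro x hx
    simp only [List.mem_map, List.mem_range] at hx
    obtain ⟨p, hp, rfl⟩ := hx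
    simpa using (hc p p le_rfl (by omega)).2.2.1

variable {k : ℕ} {c : ℕ → ℕ → ℕ} {f : ZMod (2 * (k + 4)) → ZMod (2 * (k + 4)) → ℝ}

theorem K_up' (f : ZMod (2 * (k + 4)) → ZMod (2 * (k + 4)) → ℝ) (hs : ∀ x y, f x y = f y x)
    (a : ZMod (2 * (k + 4))) {p q : ℕ} (h : p ≤ q) :
    f (a + q) (a + (p + (k + 4) : ℕ)) = K f (a + p) (q - p) := by
  rw [hs]; exact K_up f a h

theorem K_down' (f : ZMod (2 * (k + 4)) → ZMod (2 * (k + 4)) → ℝ) (hs : ∀ x y, f x y = f y x)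
    (a : ZMod (2 * (k + 4))) {p q : ℕ} (h : p ≤ q) :
    f (a + p) (a + (q + (k + 4) : ℕ)) = K f (a + (k + 4 : ℕ) + p) (q - p) := by
  rw [hs]; exact K_down f hs a h

theorem W0_cost (hc : GoodCost (k + 4) c) :
    cyc c (base k ++ [k + 1, k + 1 + (k + 4), k + 2, k + 2 + (k + 4), k + 3, k + 3 + (k + 4)]) =
      2 * (k + 4) - 2 := by
  rw [cyc_W0, base_cost hc, (hc (k+1) (k+1) (by omega) (by omega)).2.2.1,
    (hc (k+1) (k+2) (by omega) (by omega)).1,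
    (hc (k+2) (k+2) (by omega) (by omega)).2.2.1,
    (hc (k+2) (k+3) (by omega) (by omega)).1,
    (hc (k+3) (k+3) (by omega) (by omega)).2.2.1,
    (hc 0 (k+3) (by omega) (by omega)).2.2.2]
  omega

theorem W1_cost (hc : GoodCost (k + 4) c) :
    cyc c ([k + 1, k + 2 + (k + 4), k + 2, k + 3 + (k + 4), k + 3, k + 1 + (k + 4)] ++ base k) =
      2 * (k + 4) - 2 := by
  rw [cyc_W1, base_cost hc, (hc (k+1) (k+2) (by omega) (by omega)).2.2.1,
    (hc (k+2) (k+2) (by omega) (by omega)).1,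
    (hc (k+2) (k+3) (by omega) (by omega)).2.2.1,
    (hc (k+3) (k+3) (by omega) (by omega)).1,
    (hc (k+1) (k+3) (by omega) (by omega)).2.1,
    (hc 0 (k+1) (by omega) (by omega)).2.2.2]
  omega

theorem W2_cost (hc : GoodCost (k + 4) c) :
    cyc c ([k + 1, k + 3 + (k + 4), k + 3, k + 2 + (k + 4), k + 2, k + 1 + (k + 4)] ++ base k) =
      2 * (k + 4) - 2 := by
  rw [cyc_W1, base_cost hc, (hc (k+1) (k+3) (by omega) (by omega)).2.2.1,
    (hc (k+3) (k+3) (by omega) (by omega)).1,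
    (hc (k+2) (k+3) (by omega) (by omega)).2.1,
    (hc (k+2) (k+2) (by omega) (by omega)).1,
    (hc (k+1) (k+2) (by omega) (by omega)).2.1,
    (hc 0 (k+1) (by omega) (by omega)).2.2.2]
  omega

theorem W_eqs (hc : GoodCost (k + 4) c) (hf : Vanishes (k + 4) c f) (hs : ∀ x y, f x y = f y x)
    (a : ZMod (2 * (k + 4))) :
    (∃ P : ℝ,
    P + (K f (a + (k + 1 : ℕ)) 0 + (K f (a + (k + 1 : ℕ)) 1 + (K f (a + (k + 2 : ℕ)) 0 +
      (K f (a + (k + 2 : ℕ)) 1 + (K f (a + (k + 3 : ℕ)) 0 + K f (a + (k + 4 : ℕ)) (k + 3)))))) = 0 ∧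
    K f (a + (k + 4 : ℕ) + (k + 1 : ℕ)) 1 + (K f (a + (k + 2 : ℕ)) 0 +
      (K f (a + (k + 4 : ℕ) + (k + 2 : ℕ)) 1 + (K f (a + (k + 3 : ℕ)) 0 +
      (K f (a + (k + 1 : ℕ)) 2 + (K f (a + (k + 4 : ℕ)) (k + 1) + P))))) = 0 ∧
    K f (a + (k + 4 : ℕ) + (k + 1 : ℕ)) 2 + (K f (a + (k + 3 : ℕ)) 0 +
      (K f (a + (k + 2 : ℕ)) 1 + (K f (a + (k + 2 : ℕ)) 0 +
      (K f (a + (k + 1 : ℕ)) 1 + (K f (a + (k + 4 : ℕ)) (k + 1) + P))))) = 0) := by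
  refine ⟨pth (fun i j : ℕ => f (a + i) (a + j)) (base k ++ [k + 1]), ?_, ?_, ?_⟩
  · have E := hf a _ (W0_perm k) (W0_cost hc)
    rw [cyc_W0, K_up' f hs a (le_refl (k+1)), K_up f a (show k + 1 ≤ k + 2 by omega),
      K_up' f hs a (le_refl (k+2)), K_up f a (show k + 2 ≤ k + 3 by omega),
      K_up' f hs a (le_refl (k+3)), K_down f hs a (show 0 ≤ k + 3 by omega)] at E
    simpa using E
  · have E := hf a _ (W1_perm k) (W1_cost hc)
    rw [cyc_W1, K_down' f hs a (show k + 1 ≤ k + 2 by omega), K_up f a (le_refl (k + 2)),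
      K_down' f hs a (show k + 2 ≤ k + 3 by omega), K_up f a (le_refl (k + 3)),
      K_up' f hs a (show k + 1 ≤ k + 3 by omega), K_down f hs a (show 0 ≤ k + 1 by omega)] at E
    simpa using E
  · have E := hf a _ (W2_perm k) (W2_cost hc)
    rw [cyc_W1, K_down' f hs a (show k + 1 ≤ k + 3 by omega), K_up f a (le_refl (k + 3)),
      K_up' f hs a (show k + 2 ≤ k + 3 by omega), K_up f a (le_refl (k + 2)),
      K_up' f hs a (show k + 1 ≤ k + 2 by omega), K_down f hs a (show 0 ≤ k + 1 by omega)] at E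
    simpa using E

end mtours

section concl
variable {k : ℕ} {c : ℕ → ℕ → ℕ} {f : ZMod (2 * (k + 4)) → ZMod (2 * (k + 4)) → ℝ}

theorem two_d' : ((k + 4 : ℕ) : ZMod (2 * (k + 4))) + (k + 4 : ℕ) = 0 := two_d

theorem half_cases (x : ZMod (2 * (k + 4))) :
    ∃ j : ℕ, j < k + 4 ∧ (x = j ∨ x = j + (k + 4 : ℕ)) := by
  have hv : x.val < 2 * (k + 4) := ZMod.val_lt x
  by_cases h : x.val < k + 4
  · exact ⟨x.val, h, Or.inl (by simp)⟩
  · refine ⟨x.val - (k + 4), by omega, Or.inr ?_⟩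
    rw [← Nat.cast_add, Nat.sub_add_cancel (by omega)]; simp

theorem Lam_zero (hc : GoodCost (k + 4) c) (hf : Vanishes (k + 4) c f)
    (hs : ∀ x y, f x y = f y x) (hl : ∀ j : ℕ, j < k + 4 → F f j 1 2 = 0)
    (x : ZMod (2 * (k + 4))) : F f x 1 2 = 0 := by
  obtain ⟨j, hj, rfl | rfl⟩ := half_cases x
  · exact hl j hj
  · obtain ⟨P, -, h1, h2⟩ := W_eqs hc hf hs ((j : ZMod (2 * (k + 4))) - (k + 1 : ℕ))
    have h3 := hl j hj
    unfold F at h3 ⊢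
    have e1 : (j : ZMod (2 * (k + 4))) - (k + 1 : ℕ) + (k + 1 : ℕ) = j := by ring
    have e2 : (j : ZMod (2 * (k + 4))) - (k + 1 : ℕ) + (k + 2 : ℕ) = j + (1 : ℕ) := by
      push_cast; ring
    have e3 : (j : ZMod (2 * (k + 4))) - (k + 1 : ℕ) + (k + 4 : ℕ) + (k + 1 : ℕ) =
      j + (k + 4 : ℕ) := by push_cast; ring
    have e4 : (j : ZMod (2 * (k + 4))) - (k + 1 : ℕ) + (k + 4 : ℕ) + (k + 2 : ℕ) =
      j + (k + 4 : ℕ) + (1 : ℕ) := by push_cast; ring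
    rw [e1, e2, e3, e4] at h1
    rw [e1, e2, e3] at h2
    simp only [show 2 - 1 = 1 from rfl] at h3 ⊢
    linarith

theorem F_zero (hc : GoodCost (k + 4) c) (hf : Vanishes (k + 4) c f)
    (hs : ∀ x y, f x y = f y x) (hl : ∀ j : ℕ, j < k + 4 → F f j 1 2 = 0)
    (a : ZMod (2 * (k + 4))) (r t : ℕ) (hr : 1 ≤ r) (hrt : r < t) (ht : t < k + 4) :
    F f a r t = 0 := by
  have key : ∀ (a : ZMod (2 * (k + 4))) (r t : ℕ), 1 ≤ r → r + 1 < t → t < k + 4 →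
      F f a r t = 0 := by
    intro a r t hr hrt ht
    rw [exch hc hf hs a r t (r + 1) hr (by omega) ht (by rw [if_neg (by omega)]),
      show r + 1 - (r - 1) = 2 by omega]
    exact Lam_zero hc hf hs hl _
  by_cases h : t = r + 1
  · rw [exch hc hf hs a r t (k + 4 - 1) hr (by omega) ht (by rw [if_pos h])]
    by_cases h2 : k + 4 - 1 - (r - 1) = 2
    · rw [h2]; exact Lam_zero hc hf hs hl _
    · exact key _ _ _ le_rfl (by omega) (by omega)
  · exact key a r t hr (by omega) ht

theorem core (hc : GoodCost (k + 4) c) (hf : Vanishes (k + 4) c f)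
    (hs : ∀ x y, f x y = f y x) (hl : ∀ j : ℕ, j < k + 4 → F f j 1 2 = 0)
    (hg : ∀ j : ℕ, j < k + 4 → K f j 1 = 0) (x y : ZMod (2 * (k + 4))) (hxy : x ≠ y) :
    f x y = 0 := by
  have hF := F_zero hc hf hs hl
  have kadd : ∀ a l, 1 ≤ l → l + 1 < k + 4 → K f a (l + 1) = K f a l + K f (a + l) 1 := by
    intro a l h1 h2
    have := hF a l (l + 1) h1 (by omega) h2
    unfold F at this
    rw [Nat.add_sub_cancel_left] at this
    linarith
  have dz : ∀ x, K f x 0 = 0 := by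
    intro x
    obtain ⟨P, h0, h1, -⟩ := W_eqs hc hf hs (x - (k + 1 : ℕ))
    have e1 : x - (k + 1 : ℕ) + (k + 1 : ℕ) = x := by ring
    have e2 : x - (k + 1 : ℕ) + (k + 2 : ℕ) = x + (1 : ℕ) := by push_cast; ring
    have a1 := kadd (x - (k + 1 : ℕ) + (k + 4 : ℕ)) (k + 1) (by omega) (by omega)
    have a2 := kadd (x - (k + 1 : ℕ) + (k + 4 : ℕ)) (k + 2) (by omega) (by omega)
    have a3 := kadd x 1 le_rfl (by omega)
    rw [e1, e2] at h0 h1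
    simp only [show k + 1 + 1 = k + 2 from rfl, show k + 2 + 1 = k + 3 from rfl,
      show 1 + 1 = 2 from rfl] at a1 a2 a3
    linarith
  -- the all-up tours
  have path : ∀ (a : ZMod (2 * (k + 4))) (m : ℕ), m < k + 4 →
      pth (fun p r : ℕ => f (a + (p + (k + 4) : ℕ)) (a + r)) (List.range (m + 1)) = K f a m := by
    intro a m
    induction m with
    | zero => intro _; simp [pth, dz]
    | succ m ih =>
      intro hm
      have e : List.range (m + 1 + 1) = List.range m ++ m :: [m + 1] := by
        simp [List.range_succ]
      rw [e, pth_append, ← List.range_succ, ih (by omega)]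
      simp only [pth]
      rw [K_up f a (by omega)]
      rcases Nat.eq_zero_or_pos m with rfl | hm'
      · simp [dz]
      · rw [kadd a m hm' (by omega)]; simp
  have tour : ∀ a : ZMod (2 * (k + 4)), K f a (k + 3) + K f (a + (k + 4 : ℕ)) (k + 3) = 0 := by
    intro a
    have e : (0 :: List.range' 1 (k + 2) ++ [k + 4 - 1]) = List.range (k + 3 + 1) := by
      have h1 := range'_snoc 1 (k + 2)
      have h2 : List.range' 0 (k + 3 + 1) = 0 :: List.range' 1 (k + 3) := by
        rw [List.range'_succ]
      rw [List.range_eq_range', h2, h1]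
      simp; omega
    have E := ud_eq hc hf (by omega) a (List.range' 1 (k + 2)) [] (by simp)
      (by rw [e]; exact List.pairwise_lt_range) (by simp)
    rw [e, path a (k + 3) (by omega), List.sum_eq_zero] at E
    · simp only [List.cons_append, List.nil_append, pth] at E
      rw [K_down f hs a (by omega)] at E
      simpa using E
    · intro z hz
      simp only [List.mem_map, List.mem_range] at hz
      obtain ⟨p, hp, rfl⟩ := hz
      rw [K_up' f hs a (le_refl p)]
      simp [dz]
  let S : ZMod (2 * (k + 4)) → ℝ := fun x => K f x 1 + K f (x + (k + 4 : ℕ)) 1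
  have Sd : ∀ x, S (x + (k + 4 : ℕ)) = S x := by
    intro x
    simp only [S]
    rw [add_assoc, two_d', add_zero, add_comm]
  have step : ∀ a, S (a + 1) = S a := by
    have fr : ∀ a : ZMod (2 * (k + 4)),
        K f (a + 1) (k + 3) - K f a (k + 3) = K f (a + (k + 3 : ℕ)) 1 - K f a 1 := by
      intro a
      have h1 := hF a 1 (k + 3) le_rfl (by omega) (by omega)
      have h2 := kadd (a + 1) (k + 2) (by omega) (by omega)
      have e : a + 1 + ((k + 2 : ℕ) : ZMod (2 * (k + 4))) = a + (k + 3 : ℕ) := by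
        push_cast; ring
      unfold F at h1
      rw [e] at h2
      rw [show k + 3 - 1 = k + 2 by omega, Nat.cast_one] at h1
      rw [show k + 2 + 1 = k + 3 by omega] at h2
      linarith
    intro a
    have t0 := tour (a + 1)
    have t1 := tour (a + 1 + 1)
    have f0 := fr (a + 1)
    have f1 := fr (a + 1 + (k + 4 : ℕ))
    have e1 : a + 1 + ((k + 3 : ℕ) : ZMod (2 * (k + 4))) = a + (k + 4 : ℕ) := by push_cast; ring
    have e2 : a + 1 + ((k + 4 : ℕ) : ZMod (2 * (k + 4))) + (k + 3 : ℕ) = a := by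
      have := two_d' (k := k)
      push_cast at this ⊢
      linear_combination this
    have e3 : a + 1 + 1 + ((k + 4 : ℕ) : ZMod (2 * (k + 4))) = a + 1 + (k + 4 : ℕ) + 1 := by ring
    rw [e1] at f0
    rw [e2] at f1
    rw [e3] at t1
    simp only [S]
    linarith
  have const : ∀ j : ℕ, S j = S 0 := by
    intro j
    induction j with
    | zero => simp
    | succ j ih => push_cast; rw [step, ih]
  have const' : ∀ x, S x = S 0 := by
    intro x
    have := const x.val
    simpa using this
  have lin : ∀ l : ℕ, l + 1 < k + 4 →
      K f 0 (l + 1) + K f (0 + (k + 4 : ℕ)) (l + 1) = (l + 1) * S 0 := by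
    intro l
    induction l with
    | zero => intro _; simp [S]
    | succ l ih =>
      intro hl'
      rw [kadd _ (l + 1) (by omega) hl', kadd _ (l + 1) (by omega) hl']
      have h1 := ih (by omega)
      have h2 := const' (0 + (l + 1 : ℕ))
      simp only [S] at h2
      have e : (0 : ZMod (2 * (k + 4))) + (l + 1 : ℕ) + (k + 4 : ℕ) =
        0 + (k + 4 : ℕ) + (l + 1 : ℕ) := by ring
      rw [e] at h2
      simp only [S] at h1 ⊢
      push_cast at *
      linarith
  have S0 : S 0 = 0 := by
    have h1 := lin (k + 2) (by omega)
    rw [show k + 2 + 1 = k + 3 by omega, tour 0] at h1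
    have : ((k + 2 : ℕ) : ℝ) + 1 ≠ 0 := by positivity
    exact (mul_eq_zero.1 h1.symm).resolve_left this
  have g0 : ∀ x, K f x 1 = 0 := by
    intro x
    obtain ⟨j, hj, rfl | rfl⟩ := half_cases x
    · exact hg j hj
    · have := const' (j : ZMod (2 * (k + 4)))
      rw [S0] at this
      simp only [S] at this
      rw [hg j hj] at this
      linarith
  have all : ∀ (l : ℕ) (a : ZMod (2 * (k + 4))), l < k + 4 → K f a l = 0 := by
    intro l a
    induction l with
    | zero => intro _; exact dz a
    | succ l ih =>
      intro hl'
      rcases Nat.eq_zero_or_pos l with rfl | h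
      · exact g0 a
      · rw [kadd a l h hl', ih (by omega), g0]; simp
  have fin : ∀ x y : ZMod (2 * (k + 4)), (y - x + (k + 4 : ℕ)).val < k + 4 → f x y = 0 := by
    intro x y h
    have := all _ (x + (k + 4 : ℕ)) h
    unfold K at this
    rw [ZMod.natCast_zmod_val] at this
    have e1 : x + (k + 4 : ℕ) + (k + 4 : ℕ) = x := by rw [add_assoc, two_d', add_zero]
    have e2 : x + (k + 4 : ℕ) + (y - x + (k + 4 : ℕ)) = y := by
      linear_combination (two_d' (k := k))
    rwa [e1, e2] at this
  have e : x - y + ((k + 4 : ℕ) : ZMod (2 * (k + 4))) = -(y - x + (k + 4 : ℕ)) := by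
    linear_combination (two_d' (k := k))
  by_cases h : (y - x + ((k + 4 : ℕ) : ZMod (2 * (k + 4)))).val < k + 4
  · exact fin x y h
  · rw [hs]
    apply fin
    rw [e, ZMod.neg_val]
    split_ifs
    · omega
    · have hne : (y - x + ((k + 4 : ℕ) : ZMod (2 * (k + 4)))).val ≠ k + 4 := by
        intro h'
        apply hxy
        have h2 := ZMod.natCast_zmod_val (y - x + ((k + 4 : ℕ) : ZMod (2 * (k + 4))))
        rw [h'] at h2
        linear_combination h2
      omega

end concl

section walks
variable {V : Type} [DecidableEq V]

theorem sum_edges {M : Type} [AddCommMonoid M] (g : Sym2 V → M) {u v : V}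
    (p : (⊤ : SimpleGraph V).Walk u v) :
    (p.edges.map g).sum = pth (fun x y => g s(x, y)) p.support := by
  induction p with
  | nil => simp [pth]
  | cons h p ih =>
    rw [SimpleGraph.Walk.edges_cons, SimpleGraph.Walk.support_cons, List.map_cons, List.sum_cons, ih]
    cases p <;> simp [pth]

theorem exists_walk (x y : V) (l : List V) (h : (x :: l ++ [y]).Nodup) :
    ∃ p : (⊤ : SimpleGraph V).Walk x y, p.support = x :: l ++ [y] := by
  induction l generalizing x with
  | nil =>
    have hxy : x ≠ y := by simpa using h
    exact ⟨SimpleGraph.Walk.cons (by simpa using hxy) SimpleGraph.Walk.nil, by simp⟩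
  | cons z l ih =>
    rw [List.cons_append, List.nodup_cons] at h
    obtain ⟨p, hp⟩ := ih z h.2
    have hxz : x ≠ z := by
      intro e; exact h.1 (by simp [e])
    exact ⟨SimpleGraph.Walk.cons (by simpa using hxz) p, by simp [hp]⟩

theorem exists_cycle [Fintype V] (hV : 3 ≤ Fintype.card V) (L : List V) (hn : L.Nodup)
    (hl : L.length = Fintype.card V) :
    ∃ (v : V) (w : (⊤ : SimpleGraph V).Walk v v), w.IsHamiltonianCycle ∧
      ∀ (M : Type) [AddCommMonoid M] (g : Sym2 V → M),
        (w.edges.map g).sum = cyc (fun x y => g s(x, y)) L := by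
  match L, hn, hl with
  | [], _, hl => simp at hl; omega
  | [a], _, hl => simp at hl; omega
  | [a, b], _, hl => simp at hl; omega
  | x :: y :: z :: l, hn, hl =>
    have hn2 : (y :: (z :: l) ++ [x]).Nodup := by
      have : (y :: (z :: l) ++ [x]).Perm (x :: y :: z :: l) := by
        simpa using (List.perm_append_comm (l₁ := y :: z :: l) (l₂ := [x]))
      exact this.nodup_iff.2 hn
    obtain ⟨p, hp⟩ := exists_walk y x (z :: l) hn2
    have hxy : x ≠ y := by
      intro e; subst e; simp at hn
    have hadj : (⊤ : SimpleGraph V).Adj x y := by simpa using hxy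
    have hpath : p.IsPath := by rw [SimpleGraph.Walk.isPath_def, hp]; exact hn2
    refine ⟨x, SimpleGraph.Walk.cons hadj p, ?_, ?_⟩
    · rw [SimpleGraph.Walk.isHamiltonianCycle_iff_isCycle_and_length_eq]
      constructor
      · rw [SimpleGraph.Walk.cons_isCycle_iff]
        refine ⟨hpath, ?_⟩
        cases p with
        | nil => exact absurd rfl hxy
        | @cons _ v _ h q =>
          rw [SimpleGraph.Walk.edges_cons, List.mem_cons]
          rw [SimpleGraph.Walk.support_cons] at hp
          have hq : q.support = z :: (l ++ [x]) := by simpa using hp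
          have hv : v = z := by
            have := q.support_eq_cons
            rw [hq] at this
            simpa using (List.cons.inj this).1.symm
          rintro (h' | h')
          · rw [Sym2.eq_swap] at h'
            have : x = v := by
              have h2 : x = v ∨ y = v ∧ x = y := by simpa using h'
              exact h2.resolve_right (fun h => hxy h.2)
            rw [this, hv] at hn
            simp at hn
          · have hy : y ∈ q.support := q.snd_mem_support_of_mem_edges h'
            rw [SimpleGraph.Walk.cons_isPath_iff] at hpath
            exact hpath.2 hy
      · have := p.length_support
        rw [hp] at this
        simp only [List.cons_append, List.length_cons, List.length_append, List.length_nil] at this hl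
        rw [SimpleGraph.Walk.length_cons, ← hl]
        omega
    · intro M _ g
      rw [sum_edges, SimpleGraph.Walk.support_cons, hp]
      simp [cyc]

end walks

section linalg

/-- The tight incidence vectors. -/
def Tight (n : ℕ) (χ : Sym2 (ZMod n) → ℝ) : Prop :=
  ∃ (v : ZMod n) (w : (⊤ : SimpleGraph (ZMod n)).Walk v v), w.IsHamiltonianCycle ∧
    (∑ e ∈ w.edges.toFinset, circCost (n / 2) e = n - 2) ∧
    χ = fun e => if e ∈ w.edges then (1 : ℝ) else 0

theorem finish (n N : ℕ) [NeZero n] {ι : Type} [Fintype ι] (E : ι → Sym2 (ZMod n) → ℝ)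
    (hE : ∀ φ : (Sym2 (ZMod n) → ℝ) →ₗ[ℝ] ℝ, (∀ χ, Tight n χ → φ χ = 0) → (∀ i, φ (E i) = 0) → φ = 0)
    (hN : N + Fintype.card ι ≤ Fintype.card (Sym2 (ZMod n))) :
    ∃ (v : Fin N → ZMod n)
      (w : ∀ i, (⊤ : SimpleGraph (ZMod n)).Walk (v i) (v i)),
      (∀ i, (w i).IsHamiltonianCycle) ∧
      (∀ i, ∑ e ∈ (w i).edges.toFinset, circCost (n / 2) e = n - 2) ∧
      LinearIndependent ℝ
        (fun i => fun e : Sym2 (ZMod n) => if e ∈ (w i).edges then (1 : ℝ) else 0) := by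
  classical
  set T : Set (Sym2 (ZMod n) → ℝ) := {χ | Tight n χ} with hT
  have htop : Submodule.span ℝ T ⊔ Submodule.span ℝ (Set.range E) = ⊤ := by
    by_contra hne
    obtain ⟨φ, hφ, hle⟩ := Submodule.exists_le_ker_of_lt_top _ (lt_top_iff_ne_top.2 hne)
    apply hφ
    apply hE φ
    · intro χ hχ
      exact hle (Submodule.mem_sup_left (Submodule.subset_span hχ))
    · intro i
      exact hle (Submodule.mem_sup_right (Submodule.subset_span ⟨i, rfl⟩))
  have hrank : N ≤ Module.finrank ℝ (Submodule.span ℝ T) := by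
    have h1 := Submodule.finrank_add_le_finrank_add_finrank (Submodule.span ℝ T)
      (Submodule.span ℝ (Set.range E))
    rw [htop, finrank_top, Module.finrank_fintype_fun_eq_card] at h1
    have h2 := finrank_range_le_card (R := ℝ) E
    rw [Set.finrank] at h2
    omega
  obtain ⟨b, hbT, hspan, hli⟩ := exists_linearIndependent ℝ T
  have hfin : b.Finite := hli.set_finite_of_isNoetherian
  haveI := hfin.fintype
  have hcard : N ≤ Fintype.card b := by
    have := finrank_span_set_eq_card hli
    rw [hspan, Set.toFinset_card] at this
    omega
  let g : Fin N → b := fun i => (Fintype.equivFin b).symm (Fin.castLE hcard i)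
  have hg : Function.Injective g := by
    intro i j h
    simpa [g] using h
  have hmem : ∀ i, Tight n (g i).1 := fun i => hbT (g i).2
  choose v w hw hc hχ using hmem
  refine ⟨v, w, hw, hc, ?_⟩
  have e : (fun i => fun e : Sym2 (ZMod n) => if e ∈ (w i).edges then (1 : ℝ) else 0)
      = (Subtype.val ∘ g) := funext fun i => (hχ i).symm
  rw [e]
  exact hli.comp g hg

/-- Functionals as edge sums. -/
theorem phi_eq {n : ℕ} [NeZero n] (φ : (Sym2 (ZMod n) → ℝ) →ₗ[ℝ] ℝ) (l : List (Sym2 (ZMod n)))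
    (hl : l.Nodup) :
    φ (fun e => if e ∈ l then (1 : ℝ) else 0) = (l.map fun e => φ (Pi.single e 1)).sum := by
  classical
  rw [← List.sum_toFinset _ hl, ← map_sum]
  congr 1
  funext e
  simp [Finset.sum_apply, Pi.single_apply]

theorem list_zero {n : ℕ} [NeZero n] (hn : 3 ≤ n) (φ : (Sym2 (ZMod n) → ℝ) →ₗ[ℝ] ℝ)
    (hφ : ∀ χ, Tight n χ → φ χ = 0) (L : List (ZMod n)) (hL : L.Nodup) (hl : L.length = n)
    (hcost : cyc (fun x y => circCost (n / 2) s(x, y)) L = n - 2) :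
    cyc (fun x y => φ (Pi.single s(x, y) 1)) L = 0 := by
  obtain ⟨v, w, hw, hsum⟩ := exists_cycle (by simpa [ZMod.card] using hn) L hL (by simpa [ZMod.card] using hl)
  have hnd : w.edges.Nodup := hw.isCycle.isTrail.edges_nodup
  rw [← hsum ℝ (fun e => φ (Pi.single e 1)), ← phi_eq φ _ hnd]
  apply hφ
  refine ⟨v, w, hw, ?_, rfl⟩
  rw [List.sum_toFinset _ hnd, hsum, hcost]

end linalg

section final

theorem zlen {d : ℕ} (hd : 0 < d) (m : ℕ) (hm : m ≤ d) (x y : ZMod (2 * d)) (h : y - x = m) :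
    zLenSym s(x, y) = m := by
  have h0 : zLenSym s(x, y) = min (x - y).val (y - x).val := rfl
  rw [h0, h, ZMod.val_natCast, Nat.mod_eq_of_lt (by omega)]
  apply min_eq_right
  rcases Nat.eq_zero_or_pos m with rfl | hm0
  · simp
  have e : x - y = ((2 * d - m : ℕ) : ZMod (2 * d)) := by
    rw [Nat.cast_sub (by omega), ZMod.natCast_self, ← h]; ring
  rw [e, ZMod.val_natCast, Nat.mod_eq_of_lt (by omega)]
  omega

theorem cost_eq {d : ℕ} (hd : 0 < d) (he : Even d) (δ : ℕ) (hδ : δ < d) (x y : ZMod (2 * d))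
    (h : y - x = δ + d) :
    circCost d s((1 + (d : ZMod (2 * d))) * x, (1 + (d : ZMod (2 * d))) * y) = δ := by
  obtain ⟨m, hm⟩ := he
  have h2 := two_d (d := d)
  have hdd : (d : ZMod (2 * d)) * d = 0 := by
    have : ((d * d : ℕ) : ZMod (2 * d)) = 0 := by
      rw [ZMod.natCast_eq_zero_iff]
      exact ⟨m, by rw [hm]; ring⟩
    simpa using this
  have hdiff : (1 + (d : ZMod (2 * d))) * y - (1 + (d : ZMod (2 * d))) * x = δ + d + d * δ := by
    have : (1 + (d : ZMod (2 * d))) * y - (1 + (d : ZMod (2 * d))) * x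
      = (1 + (d : ZMod (2 * d))) * (y - x) := by ring
    rw [this, h]; linear_combination hdd
  rcases Nat.even_or_odd δ with hp | hp
  · have hz : zLenSym s((1 + (d : ZMod (2 * d))) * x, (1 + (d : ZMod (2 * d))) * y) = d - δ := by
      rw [Sym2.eq_swap]
      apply zlen hd _ (by omega)
      obtain ⟨r, hr⟩ := hp
      have hr' : (δ : ZMod (2 * d)) = r + r := by rw [hr]; push_cast; ring
      rw [Nat.cast_sub hδ.le]
      rw [hr'] at hdiff ⊢
      linear_combination -hdiff - (1 + (r : ZMod (2 * d))) * h2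
    rw [circCost, hz, if_neg]
    · omega
    · rw [Nat.not_odd_iff_even]
      obtain ⟨r, hr⟩ := hp
      exact ⟨m - r, by omega⟩
  · have hz : zLenSym s((1 + (d : ZMod (2 * d))) * x, (1 + (d : ZMod (2 * d))) * y) = δ := by
      apply zlen hd _ (by omega)
      obtain ⟨r, hr⟩ := hp
      have hr' : (δ : ZMod (2 * d)) = 2 * r + 1 := by rw [hr]; push_cast; ring
      rw [hr'] at hdiff ⊢
      linear_combination hdiff + (1 + (r : ZMod (2 * d))) * h2
    rw [circCost, hz, if_pos hp]

/-- Cost in antipodal coordinates. -/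
def cst (d : ℕ) (i j : ℕ) : ℕ :=
  circCost d s((1 + (d : ZMod (2 * d))) * (i : ZMod (2 * d)), (1 + (d : ZMod (2 * d))) * (j : ZMod (2 * d)))

theorem cst_comm (d i j : ℕ) : cst d i j = cst d j i := by
  unfold cst; rw [Sym2.eq_swap]

theorem good_cst {d : ℕ} (he : Even d) : GoodCost d (cst d) := by
  intro p q hpq hq
  have hd : 0 < d := by omega
  have h2 := two_d (d := d)
  have h1 : cst d (p + d) q = q - p := by
    apply cost_eq hd he _ (by omega)
    rw [Nat.cast_sub hpq]; push_cast; linear_combination -h2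
  have h3 : cst d p (q + d) = q - p := by
    apply cost_eq hd he _ (by omega)
    rw [Nat.cast_sub hpq]; push_cast; ring
  exact ⟨h1, by rw [cst_comm, h1], h3, by rw [cst_comm, h3]⟩

theorem cst_trans (d i j : ℕ) (a : ZMod (2 * d)) :
    circCost d s((1 + (d : ZMod (2 * d))) * (a + (i : ZMod (2 * d))), (1 + (d : ZMod (2 * d))) * (a + (j : ZMod (2 * d)))) = cst d i j := by
  have : zLenSym s((1 + (d : ZMod (2 * d))) * (a + (i : ZMod (2 * d))), (1 + (d : ZMod (2 * d))) * (a + (j : ZMod (2 * d))))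
      = zLenSym s((1 + (d : ZMod (2 * d))) * (i : ZMod (2 * d)), (1 + (d : ZMod (2 * d))) * (j : ZMod (2 * d))) := by
    change min _ _ = min _ _
    congr 2 <;> ring
  rw [cst, circCost, circCost, this]

theorem mu_mu {d : ℕ} (he : Even d) (x : ZMod (2 * d)) :
    (1 + (d : ZMod (2 * d))) * ((1 + (d : ZMod (2 * d))) * x) = x := by
  obtain ⟨m, hm⟩ := he
  have h2 := two_d (d := d)
  have hdd : (d : ZMod (2 * d)) * d = 0 := by
    have : ((d * d : ℕ) : ZMod (2 * d)) = 0 := by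
      rw [ZMod.natCast_eq_zero_iff]
      exact ⟨m, by rw [hm]; ring⟩
    simpa using this
  linear_combination x * hdd + x * h2

theorem vanishes {d : ℕ} [NeZero (2 * d)] (hd : 2 ≤ d) (he : Even d) (φ : (Sym2 (ZMod (2 * d)) → ℝ) →ₗ[ℝ] ℝ)
    (hφ : ∀ χ, Tight (2 * d) χ → φ χ = 0) :
    Vanishes d (cst d) (fun x y =>
      φ (Pi.single s((1 + (d : ZMod (2 * d))) * x, (1 + (d : ZMod (2 * d))) * y) 1)) := by
  intro a L hL hcost
  have hdiv : 2 * d / 2 = d := by omega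
  have key := list_zero (by omega) φ hφ
    (L.map (fun i : ℕ => (1 + (d : ZMod (2 * d))) * (a + (i : ZMod (2 * d))))) ?_ ?_ ?_
  · rw [cyc_map] at key
    exact key
  · apply List.Nodup.map_on _ (hL.nodup_iff.2 List.nodup_range)
    intro i hi j hj hij
    have hi' := List.mem_range.1 (hL.mem_iff.1 hi)
    have hj' := List.mem_range.1 (hL.mem_iff.1 hj)
    have h := congrArg (fun z => (1 + (d : ZMod (2 * d))) * z) hij
    simp only [mu_mu he] at h
    have h' := congrArg ZMod.val (add_left_cancel h)
    rwa [ZMod.val_natCast, ZMod.val_natCast, Nat.mod_eq_of_lt hi', Nat.mod_eq_of_lt hj'] at h'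
  · rw [List.length_map, hL.length_eq, List.length_range]
  · rw [cyc_map, hdiv, ← hcost]
    congr 1
    funext i j
    exact cst_trans d i j a

theorem phi_zero {n : ℕ} [NeZero n] (φ : (Sym2 (ZMod n) → ℝ) →ₗ[ℝ] ℝ)
    (h : ∀ x y, φ (Pi.single s(x, y) 1) = 0) : φ = 0 := by
  apply LinearMap.pi_ext'
  intro e
  induction e using Sym2.ind with
  | _ x y =>
    apply LinearMap.ext_ring
    simpa using h x y

theorem big (k : ℕ) (he : Even (k + 4)) (n : ℕ) (hn : n = 2 * (k + 4)) :
    ∃ (v : Fin (n * (n - 3) / 2) → ZMod n)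
      (w : ∀ i, (⊤ : SimpleGraph (ZMod n)).Walk (v i) (v i)),
      (∀ i, (w i).IsHamiltonianCycle) ∧
      (∀ i, ∑ e ∈ (w i).edges.toFinset, circCost (n / 2) e = n - 2) ∧
      LinearIndependent ℝ
        (fun i => fun e : Sym2 (ZMod n) => if e ∈ (w i).edges then (1 : ℝ) else 0) := by
  subst hn
  haveI : NeZero (2 * (k + 4)) := ⟨by omega⟩
  let S : ZMod (2 * (k + 4)) → ZMod (2 * (k + 4)) → (Sym2 (ZMod (2 * (k + 4))) → ℝ) := fun x y =>
    Pi.single s((1 + ((k + 4 : ℕ) : ZMod (2 * (k + 4)))) * x, (1 + ((k + 4 : ℕ) : ZMod (2 * (k + 4)))) * y) 1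
  let KS : ZMod (2 * (k + 4)) → ZMod (2 * (k + 4)) → (Sym2 (ZMod (2 * (k + 4))) → ℝ) := fun a l =>
    S (a + (k + 4 : ℕ)) (a + l)
  apply finish (2 * (k + 4)) _ (ι := ZMod (2 * (k + 4)) ⊕ (Fin (k + 4) ⊕ Fin (k + 4)))
    (Sum.elim (fun x => S x x) (Sum.elim (fun j => KS (j : ℕ) (1 : ℕ))
      (fun j => KS (j : ℕ) (1 : ℕ) + KS ((j : ℕ) + (1 : ℕ)) ((2 - 1 : ℕ)) - KS (j : ℕ) (2 : ℕ))))
  · intro φ hφ hE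
    have hv := vanishes (by omega) he φ hφ
    have hall : ∀ x y, φ (S x y) = 0 := by
      intro x y
      by_cases hxy : x = y
      · subst hxy
        simpa using hE (Sum.inl x)
      · refine core (good_cst he) hv ?_ ?_ ?_ x y hxy
        · intro x y
          simp only [Sym2.eq_swap]
        · intro j hj
          have := hE (Sum.inr (Sum.inr ⟨j, hj⟩))
          simp only [Sum.elim_inr, map_add, map_sub] at this
          simpa [F, K, KS, S] using this
        · intro j hj
          have := hE (Sum.inr (Sum.inl ⟨j, hj⟩))
          simpa [K, KS, S] using this
    apply phi_zero
    intro x y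
    have := hall ((1 + ((k + 4 : ℕ) : ZMod (2 * (k + 4)))) * x) ((1 + ((k + 4 : ℕ) : ZMod (2 * (k + 4)))) * y)
    simp only [S, mu_mu he] at this
    exact this
  · rw [Sym2.card, Fintype.card_sum, Fintype.card_sum, Fintype.card_fin, ZMod.card, Nat.choose_two_right]
    have h1 : 2 * (k + 4) * (2 * (k + 4) - 3) / 2 = (k + 4) * (2 * k + 5) := by
      rw [show 2 * (k + 4) - 3 = 2 * k + 5 by omega, mul_assoc, Nat.mul_div_cancel_left _ (by norm_num)]
    have h2 : (2 * (k + 4) + 1) * (2 * (k + 4) + 1 - 1) / 2 = (k + 4) * (2 * k + 9) := by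
      rw [show (2 * (k + 4) + 1) * (2 * (k + 4) + 1 - 1) = 2 * ((k + 4) * (2 * k + 9)) by
        rw [Nat.add_sub_cancel]; ring, Nat.mul_div_cancel_left _ (by norm_num)]
    rw [h1, h2]
    nlinarith

theorem small :
    ∃ (v : Fin (4 * (4 - 3) / 2) → ZMod 4)
      (w : ∀ i, (⊤ : SimpleGraph (ZMod 4)).Walk (v i) (v i)),
      (∀ i, (w i).IsHamiltonianCycle) ∧
      (∀ i, ∑ e ∈ (w i).edges.toFinset, circCost (4 / 2) e = 4 - 2) ∧
      LinearIndependent ℝ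
        (fun i => fun e : Sym2 (ZMod 4) => if e ∈ (w i).edges then (1 : ℝ) else 0) := by
  let E : Fin 8 → Sym2 (ZMod 4) := ![s(0, 0), s(1, 1), s(2, 2), s(3, 3), s(0, 1), s(0, 2), s(0, 3), s(1, 3)]
  apply finish 4 _ (ι := Fin 8) (fun i => Pi.single (E i) 1)
  · intro φ hφ hE
    have t1 := list_zero (by norm_num) φ hφ [0, 2, 1, 3] (by decide) rfl (by decide)
    have t2 := list_zero (by norm_num) φ hφ [0, 1, 3, 2] (by decide) rfl (by decide)
    have e0 : φ (Pi.single s(0, 0) 1) = 0 := hE 0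
    have e1 : φ (Pi.single s(1, 1) 1) = 0 := hE 1
    have e2 : φ (Pi.single s(2, 2) 1) = 0 := hE 2
    have e3 : φ (Pi.single s(3, 3) 1) = 0 := hE 3
    have e4 : φ (Pi.single s(0, 1) 1) = 0 := hE 4
    have e5 : φ (Pi.single s(0, 2) 1) = 0 := hE 5
    have e6 : φ (Pi.single s(0, 3) 1) = 0 := hE 6
    have e7 : φ (Pi.single s(1, 3) 1) = 0 := hE 7
    have e4' : φ (Pi.single s(1, 0) 1) = 0 := by rw [Sym2.eq_swap]; exact e4
    have e5' : φ (Pi.single s(2, 0) 1) = 0 := by rw [Sym2.eq_swap]; exact e5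
    have e6' : φ (Pi.single s(3, 0) 1) = 0 := by rw [Sym2.eq_swap]; exact e6
    have e7' : φ (Pi.single s(3, 1) 1) = 0 := by rw [Sym2.eq_swap]; exact e7
    have e8 : φ (Pi.single s(2, 1) 1) = 0 := by
      simp only [cyc, pth, List.cons_append, List.nil_append] at t1
      linarith
    have e9 : φ (Pi.single s(3, 2) 1) = 0 := by
      simp only [cyc, pth, List.cons_append, List.nil_append] at t2
      linarith
    have e8' : φ (Pi.single s(1, 2) 1) = 0 := by rw [Sym2.eq_swap]; exact e8
    have e9' : φ (Pi.single s(2, 3) 1) = 0 := by rw [Sym2.eq_swap]; exact e9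
    apply phi_zero
    intro x y
    change Fin 4 at x y
    fin_cases x <;> fin_cases y <;> assumption
  · rw [Sym2.card, ZMod.card, Fintype.card_fin]
    decide

end final
end Circlet

theorem circlet_facet_defining (n : ℕ) (h4 : 4 ∣ n) :
    ∃ (v : Fin (n * (n - 3) / 2) → ZMod n)
      (w : ∀ i, (⊤ : SimpleGraph (ZMod n)).Walk (v i) (v i)),
      (∀ i, (w i).IsHamiltonianCycle) ∧
      (∀ i, ∑ e ∈ (w i).edges.toFinset, circCost (n / 2) e = n - 2) ∧
      LinearIndependent ℝ
        (fun i => fun e : Sym2 (ZMod n) => if e ∈ (w i).edges then (1 : ℝ) else 0) := by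
  obtain ⟨m, rfl⟩ := h4
  match m with
  | 0 =>
    haveI : IsEmpty (Fin (4 * 0 * (4 * 0 - 3) / 2)) := ⟨fun i => by
      have h := i.2
      simp at h⟩
    exact ⟨fun i => isEmptyElim i, fun i => isEmptyElim i, fun i => isEmptyElim i,
      fun i => isEmptyElim i, linearIndependent_empty_type⟩
  | 1 => exact Circlet.small
  | m + 2 => exact Circlet.big (2 * m) ⟨m + 2, by ring⟩ _ (by ring)
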